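/- Let A be an n×n dual quaternion Hermitian matrix, and let x, y ∈ 𝔻ℚ^n be appreciable vectors with A x = x λ and A y = y μ, where λ = λ_st + λ_I ε and μ = μ_st + μ_I ε are dual numbers with distinct standard parts λ_st ≠ μ_st. Then x and y are orthogonal: x* y = 0. -/

import Mathlib

open TrivSqZeroExt Matrix

/-- The quaternions. -/
abbrev HQ := Quaternion ℝ

/-- The dual quaternions: `q = q_st + q_I ε` with `ε² = 0`, `ε` commuting with quaternions. -/
abbrev DQ := DualNumber HQ

/-- Conjugation of a dual quaternion: `q* = q_st* + q_I* ε`. -/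
noncomputable instance : Star DQ :=
  ⟨fun q => inl (star (fst q)) + inr (star (snd q))⟩

/-- A dual quaternion is appreciable if its standard part is nonzero. -/
def DQ.Appreciable (q : DQ) : Prop := fst q ≠ 0

/-- A dual quaternion is a dual number if both parts are real. -/
def DQ.IsDualNum (q : DQ) : Prop := ∃ a b : ℝ, q = inl (a : HQ) + inr (b : HQ)

/-- The total order on dual numbers: `p ≤ q` iff `p_st < q_st`, or `p_st = q_st` and `p_I ≤ q_I`. -/
def DQ.le (p q : DQ) : Prop :=
  (fst p).re < (fst q).re ∨ ((fst p).re = (fst q).re ∧ (snd p).re ≤ (snd q).re)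

/-- The strict total order on dual numbers. -/
def DQ.lt (p q : DQ) : Prop :=
  (fst p).re < (fst q).re ∨ ((fst p).re = (fst q).re ∧ (snd p).re < (snd q).re)

@[simp]
theorem DQ.fst_star (q : DQ) : fst (star q) = star (fst q) := by
  change fst (inl (star (fst q)) + inr (star (snd q))) = _
  simp

@[simp]
theorem DQ.snd_star (q : DQ) : snd (star q) = star (snd q) := by
  change snd (inl (star (fst q)) + inr (star (snd q))) = _
  simp

/-- Conjugation makes the dual quaternions a star ring. -/
@[reducible]
noncomputable def DQ.starRing : StarRing DQ where
  star_involutive q := by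
    apply TrivSqZeroExt.ext <;> simp
  star_mul p q := by
    apply TrivSqZeroExt.ext <;> simp [add_comm]
  star_add p q := by
    apply TrivSqZeroExt.ext <;> simp

/-- Dual numbers are fixed by conjugation. -/
theorem DQ.IsDualNum.star_eq {q : DQ} (hq : DQ.IsDualNum q) : star q = q := by
  obtain ⟨a, b, rfl⟩ := hq
  apply TrivSqZeroExt.ext <;> simp

/-- Dual numbers are central among the dual quaternions. -/
theorem DQ.IsDualNum.commute {q : DQ} (hq : DQ.IsDualNum q) (p : DQ) : Commute p q := by
  obtain ⟨a, b, rfl⟩ := hq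
  apply TrivSqZeroExt.ext
  · simp [(Quaternion.coe_commutes a _).symm]
  · simp [(Quaternion.coe_commutes a _).symm, (Quaternion.coe_commutes b _).symm, add_comm]

/-- Two eigenvectors of a dual quaternion Hermitian matrix associated with two eigenvalues
having distinct standard parts are orthogonal. -/
theorem eigenvectors_distinct_standard_parts_orthogonal {n : ℕ}
    (A : Matrix (Fin n) (Fin n) DQ) (hA : A.IsHermitian)
    (lam mu : DQ) (x y : Fin n → DQ)
    (hlam : DQ.IsDualNum lam) (hmu : DQ.IsDualNum mu)
    (hx : ∃ i, fst (x i) ≠ 0) (hy : ∃ i, fst (y i) ≠ 0)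
    (heigx : A.mulVec x = fun i => x i * lam)
    (heigy : A.mulVec y = fun i => y i * mu)
    (hne : fst lam ≠ fst mu) :
    ∑ i, star (x i) * y i = 0 := by
  let _ := DQ.starRing
  have hS : lam * (star x ⬝ᵥ y) = (star x ⬝ᵥ y) * mu := by
    have hy_smul : A *ᵥ y = MulOpposite.op mu • y := heigy
    have hx_smul : star (A *ᵥ x) = lam • star x := by
      rw [heigx]
      funext i
      simp [star_mul, hlam.star_eq]
    rw [← smul_eq_mul, ← smul_dotProduct, ← hx_smul, star_mulVec, hA.eq, ← dotProduct_mulVec,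
      hy_smul, dotProduct_smul, op_smul_eq_mul]
  have hzero : (lam - mu) * (star x ⬝ᵥ y) = 0 := by
    rw [sub_mul, hS, (hmu.commute _).eq, sub_self]
  have hst : fst (lam - mu) ≠ 0 := by
    rw [fst_sub]
    exact sub_ne_zero.mpr hne
  calc
    ∑ i, star (x i) * y i = (lam - mu)⁻¹ * (lam - mu) * (star x ⬝ᵥ y) := by
      rw [TrivSqZeroExt.inv_mul_cancel hst, one_mul]
      rfl
    _ = 0 := by rw [mul_assoc, hzero, mul_zero]
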